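/- For all integers n ≥ 0, the sequence Z_l(n,0) satisfies the first-order inhomogeneous recurrence -16(2n+1)⁴ Z_l(n,0) - (n+1)⁴ Z_l(n+1,0) = -((-1)^n (n!)⁸ (1+2n)_{2n} (1+4n)(831 + 5265n + 12601n² + 13499n³ + 5460n⁴)) / (48 ((2n+1)!)⁵). -/

import Mathlib

open scoped BigOperators

/-- The Pochhammer symbol `(x)_k = x (x+1) ⋯ (x+k-1)` for a real `x`. -/
noncomputable def poch (x : ℝ) (k : ℕ) : ℝ := ∏ i ∈ Finset.range k, (x + i)

/-- The rational function `R_{n,m}(t)` from the paper. -/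
noncomputable def R (n m : ℕ) (t : ℝ) : ℝ :=
  (-1 : ℝ) ^ m * (t + n / 2) * (poch (t - n) m / m.factorial) *
    (poch (t - 2 * n + m) (2 * n - m) / (2 * n - m).factorial) *
    (poch (t + n + 1) n / poch t (n + 1)) *
    (poch (t + n + 1) (2 * n - m) / poch t (2 * n - m + 1)) *
    ((n.factorial : ℝ) / poch t (n + 1)) ^ 2

/-- The rational function `R̃_{n,m}(t)` from the paper. -/
noncomputable def Rtilde (n m : ℕ) (t : ℝ) : ℝ :=
  ((n.factorial : ℝ) * poch (t - n) (2 * n - m) / (poch t (n + 1) * poch t (2 * n - m + 1))) *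
    ∑ j ∈ Finset.range (n + 1),
      (n.choose j : ℝ) ^ 2 * ((2 * n - m + j).choose n : ℝ) * poch (t - j) n / n.factorial

/-- `Z_l(n,m) = -(1/3) Σ_{ν=n-m+1}^∞ (d/dt R_{n,m}(t))|_{t=ν}`. -/
noncomputable def Zl (n m : ℕ) : ℝ :=
  -(1 / 3) * ∑' ν : ℕ, deriv (R n m) ((n : ℝ) - m + 1 + ν)

/-- `Z_r(n,m) = (1/6) Σ_{ν=1}^∞ (d²/dt² R̃_{n,m}(t))|_{t=ν}`. -/
noncomputable def Zr (n m : ℕ) : ℝ :=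
  (1 / 6) * ∑' ν : ℕ, deriv (deriv (Rtilde n m)) (1 + (ν : ℝ))

/-- `U_k(n) = Σ_{i=0}^n C(4i,2i) / ((2i+1)^k C(2i,i)^8)`. -/
noncomputable def U (k n : ℕ) : ℝ :=
  ∑ i ∈ Finset.range (n + 1),
    ((4 * i).choose (2 * i) : ℝ) / ((2 * i + 1) ^ k * ((2 * i).choose i : ℝ) ^ 8)

/-- The harmonic number `S₁(N) = Σ_{i=1}^N 1/i`. -/
noncomputable def S1 (N : ℕ) : ℝ := ∑ i ∈ Finset.range N, (1 : ℝ) / (i + 1)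


open Filter Topology Asymptotics

theorem poch_succ (x : ℝ) (k : ℕ) : poch x (k + 1) = poch x k * (x + k) :=
  Finset.prod_range_succ _ _

theorem poch_add (x : ℝ) (j k : ℕ) : poch x (j + k) = poch x j * poch (x + j) k := by
  simp only [poch, Finset.prod_range_add, Nat.cast_add, add_assoc]

theorem poch_succ_left (x : ℝ) (k : ℕ) : poch x (k + 1) = x * poch (x + 1) k := by
  rw [add_comm k 1, poch_add]
  simp [poch]

theorem poch_pos {x : ℝ} (hx : 0 < x) (k : ℕ) : 0 < poch x k :=
  Finset.prod_pos fun _ _ => by positivity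

theorem poch_natCast_succ (m k : ℕ) :
    poch ((m : ℝ) + 1) k * m.factorial = (m + k).factorial := by
  induction k with
  | zero => simp [poch]
  | succ k ih =>
    rw [poch_succ, ← add_assoc, Nat.factorial_succ, Nat.cast_mul, ← ih]
    push_cast
    ring

theorem poch_neg_natCast (n : ℕ) : poch (-(n : ℝ)) n = (-1) ^ n * n.factorial := by
  induction n with
  | zero => simp [poch]
  | succ n ih =>
    rw [poch_succ_left, pow_succ, Nat.factorial_succ,
      show (-((n + 1 : ℕ) : ℝ) + 1) = -(n : ℝ) by push_cast; ring, ih]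
    push_cast
    ring

theorem differentiable_poch (k : ℕ) : Differentiable ℝ fun t => poch t k := by
  unfold poch
  fun_prop

theorem differentiableAt_poch_add (c : ℝ) (k : ℕ) (t : ℝ) :
    DifferentiableAt ℝ (fun t => poch (t + c) k) t := by
  unfold poch
  fun_prop

/-- Functions with the growth of `t ^ k` at infinity whose derivative grows like `t ^ (k - 1)`. -/
structure IsSymbol (k : ℤ) (f : ℝ → ℝ) : Prop where
  differentiable : ∀ᶠ t in atTop, DifferentiableAt ℝ f t
  isBigO : f =O[atTop] fun t : ℝ => t ^ k
  isBigO_deriv : deriv f =O[atTop] fun t : ℝ => t ^ (k - 1)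

namespace IsSymbol

variable {k l : ℤ} {f g : ℝ → ℝ}

theorem congr (hf : IsSymbol k f) (h : f =ᶠ[atTop] g) : IsSymbol k g := by
  have h' : ∀ᶠ t in atTop, f =ᶠ[𝓝 t] g := by
    obtain ⟨a, ha⟩ := eventually_atTop.1 h
    filter_upwards [eventually_gt_atTop a] with t ht
    filter_upwards [lt_mem_nhds ht] with s hs using ha s hs.le
  refine ⟨?_, hf.isBigO.congr' h EventuallyEq.rfl,
    hf.isBigO_deriv.congr' (h'.mono fun t ht => ht.deriv_eq) EventuallyEq.rfl⟩
  filter_upwards [hf.differentiable, h'] with t ht hs using ht.congr_of_eventuallyEq hs.symm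

theorem mul (hf : IsSymbol k f) (hg : IsSymbol l g) :
    IsSymbol (k + l) fun t => f t * g t := by
  refine ⟨?_, ?_, ?_⟩
  · filter_upwards [hf.differentiable, hg.differentiable] with t h₁ h₂ using h₁.mul h₂
  · refine (hf.isBigO.mul hg.isBigO).congr' EventuallyEq.rfl ?_
    filter_upwards [eventually_gt_atTop 0] with t ht
    rw [zpow_add₀ ht.ne']
  · have h₁ : (fun t => deriv f t * g t) =O[atTop] fun t : ℝ => t ^ (k + l - 1) := by
      refine (hf.isBigO_deriv.mul hg.isBigO).congr' EventuallyEq.rfl ?_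
      filter_upwards [eventually_gt_atTop 0] with t ht
      rw [← zpow_add₀ ht.ne']
      congr 1
      ring
    have h₂ : (fun t => f t * deriv g t) =O[atTop] fun t : ℝ => t ^ (k + l - 1) := by
      refine (hf.isBigO.mul hg.isBigO_deriv).congr' EventuallyEq.rfl ?_
      filter_upwards [eventually_gt_atTop 0] with t ht
      rw [← zpow_add₀ ht.ne']
      congr 1
      ring
    refine (h₁.add h₂).congr' ?_ EventuallyEq.rfl
    filter_upwards [hf.differentiable, hg.differentiable] with t h₁ h₂
    exact (deriv_fun_mul h₁ h₂).symm

theorem const (c : ℝ) : IsSymbol 0 fun _ => c := by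
  refine ⟨Eventually.of_forall fun t => by fun_prop, ?_, ?_⟩
  · simpa using isBigO_const_const c (one_ne_zero (α := ℝ)) (atTop : Filter ℝ)
  · simpa using isBigO_zero _ _

theorem add (hf : IsSymbol k f) (hg : IsSymbol k g) : IsSymbol k fun t => f t + g t := by
  refine ⟨?_, hf.isBigO.add hg.isBigO,
    (hf.isBigO_deriv.add hg.isBigO_deriv).congr' ?_ EventuallyEq.rfl⟩
  · filter_upwards [hf.differentiable, hg.differentiable] with t h₁ h₂ using h₁.add h₂
  · filter_upwards [hf.differentiable, hg.differentiable] with t h₁ h₂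
    exact (deriv_fun_add h₁ h₂).symm

theorem of_le (hf : IsSymbol k f) (h : k ≤ l) : IsSymbol l f := by
  have key : ∀ i j : ℤ, i ≤ j → (fun t : ℝ => t ^ i) =O[atTop] (fun t : ℝ => t ^ j) := by
    intro i j hij
    refine IsBigO.of_bound 1 ?_
    filter_upwards [eventually_ge_atTop (1 : ℝ)] with t ht
    have h0 : 0 ≤ t := zero_le_one.trans ht
    rw [one_mul, Real.norm_of_nonneg (by positivity), Real.norm_of_nonneg (by positivity)]
    exact zpow_le_zpow_right₀ ht hij
  exact ⟨hf.differentiable, hf.isBigO.trans (key _ _ h),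
    hf.isBigO_deriv.trans (key _ _ (by lia))⟩

theorem id_add (c : ℝ) : IsSymbol 1 fun t => t + c := by
  refine ⟨Eventually.of_forall fun t => by fun_prop, ?_, ?_⟩
  · refine IsBigO.of_bound 2 ?_
    filter_upwards [eventually_ge_atTop |c|] with t ht
    have h0 : 0 ≤ t := (abs_nonneg c).trans ht
    rw [zpow_one, Real.norm_eq_abs, Real.norm_of_nonneg h0]
    linarith [abs_add_le t c, abs_of_nonneg h0]
  · simpa using isBigO_const_const (1 : ℝ) (one_ne_zero (α := ℝ)) (atTop : Filter ℝ)

theorem inv_id_add (c : ℝ) : IsSymbol (-1) fun t => (t + c)⁻¹ := by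
  have hb : (fun t : ℝ => (t + c)⁻¹) =O[atTop] fun t : ℝ => t ^ (-1 : ℤ) := by
    refine IsBigO.of_bound 2 ?_
    filter_upwards [eventually_gt_atTop (2 * |c|)] with t ht
    have h0 : 0 < t := lt_of_le_of_lt (by positivity) ht
    have h1 : t / 2 ≤ t + c := by linarith [neg_abs_le c]
    have h2 : 0 ≤ t⁻¹ := inv_nonneg.2 h0.le
    rw [zpow_neg_one, Real.norm_of_nonneg h2,
      Real.norm_of_nonneg (inv_nonneg.2 (by linarith))]
    calc (t + c)⁻¹ ≤ (t / 2)⁻¹ := inv_anti₀ (by positivity) h1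
      _ = 2 * t⁻¹ := by field_simp
  have hne : ∀ᶠ t in atTop, t + c ≠ 0 := by
    filter_upwards [eventually_gt_atTop (-c)] with t ht
    linarith
  refine ⟨?_, hb, ?_⟩
  · filter_upwards [hne] with t ht
    fun_prop (disch := assumption)
  · refine ((hb.mul hb).const_mul_left (-1)).congr' ?_ ?_
    · filter_upwards [hne] with t ht
      rw [(((hasDerivAt_id' t).add_const c).fun_inv ht).deriv]
      field_simp
    · filter_upwards [eventually_gt_atTop 0] with t ht
      rw [← zpow_add₀ ht.ne']
      norm_num

theorem pow (hf : IsSymbol k f) (j : ℕ) : IsSymbol (j * k) fun t => f t ^ j := by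
  induction j with
  | zero => simpa using const 1
  | succ j ih =>
    convert ih.mul hf using 1
    · push_cast
      ring
    · simp only [pow_succ]

theorem poch_add (c : ℝ) (j : ℕ) : IsSymbol j fun t => poch (t + c) j := by
  induction j with
  | zero => simpa [poch] using const 1
  | succ j ih => simpa [poch_succ, add_assoc] using ih.mul (id_add (c + j))

theorem inv_poch (j : ℕ) : IsSymbol (-j) fun t => (poch t j)⁻¹ := by
  induction j with
  | zero => simpa [poch] using const 1
  | succ j ih =>
    convert ih.mul (inv_id_add j) using 1
    · push_cast
      ring
    · ext t
      rw [poch_succ, mul_inv]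

end IsSymbol

/-- The factor of `R n 0 t` without positive zeros, apart from the linear one. -/
noncomputable def regularFactor (n : ℕ) (t : ℝ) : ℝ :=
  (n.factorial : ℝ) ^ 2 / (2 * n).factorial *
    (poch (t + (n + 1)) (2 * n) * (poch t (n + 1))⁻¹ ^ 4)

theorem R_zero_eq (n : ℕ) {t : ℝ} (ht : 0 < t) :
    R n 0 t = (t + n / 2) * poch (t + -(2 * n)) (2 * n) * regularFactor n t := by
  have h₁ := (poch_pos ht (n + 1)).ne'
  have h₂ := (poch_pos (show 0 < t + n + 1 by positivity) n).ne'
  have h₃ : poch t (2 * n + 1) = poch t (n + 1) * poch (t + n + 1) n := by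
    rw [show 2 * n + 1 = (n + 1) + n by ring, poch_add]
    push_cast
    rw [add_assoc]
  have h₄ : poch (t - n) 0 = 1 := Finset.prod_range_zero _
  simp only [R, regularFactor, Nat.sub_zero, h₃, h₄, ← sub_eq_add_neg, ← add_assoc, Nat.cast_zero,
    add_zero, Nat.factorial_zero, Nat.cast_one]
  field_simp

theorem regularFactor_succ (n : ℕ) {t : ℝ} (ht : 0 < t) :
    regularFactor (n + 1) t = (n + 1) / (2 * (2 * n + 1)) *
      ((t + 3 * n + 1) * (t + 3 * n + 2) * (t + 3 * n + 3) / (t + n + 1) ^ 5) *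
        regularFactor n t := by
  have h₁ := (poch_pos ht (n + 1)).ne'
  have h₂ : poch (t + ((n + 1 : ℕ) + 1)) (2 * (n + 1)) * (t + (n + 1)) =
      poch (t + (n + 1)) (2 * n) *
        ((t + 3 * n + 1) * (t + 3 * n + 2) * (t + 3 * n + 3)) := by
    rw [show 2 * (n + 1) = 2 * n + 1 + 1 by ring,
      show t + (((n + 1 : ℕ) : ℝ) + 1) = t + (n + 1) + 1 by push_cast; ring, mul_comm,
      ← poch_succ_left, poch_succ, poch_succ, poch_succ]
    push_cast
    ring
  rw [← eq_div_iff (by positivity)] at h₂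
  rw [regularFactor, regularFactor, h₂, poch_succ t (n + 1),
    show 2 * (n + 1) = 2 * n + 1 + 1 by ring]
  simp only [Nat.factorial_succ]
  push_cast
  field_simp
  ring

theorem regularFactor_add_one (n : ℕ) {t : ℝ} (ht : 0 < t) :
    regularFactor n (t + 1) =
      (t + 3 * n + 1) * t ^ 4 / (t + n + 1) ^ 5 * regularFactor n t := by
  have h₁ := (poch_pos ht (n + 1)).ne'
  have h₂ : (t + (n + 1)) * poch (t + 1 + (n + 1)) (2 * n) =
      poch (t + (n + 1)) (2 * n) * (t + 3 * n + 1) := by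
    rw [show t + 1 + ((n : ℝ) + 1) = t + (n + 1) + 1 by ring, ← poch_succ_left, poch_succ]
    push_cast
    ring
  have h₃ : t * poch (t + 1) (n + 1) = poch t (n + 1) * (t + n + 1) := by
    rw [← poch_succ_left, poch_succ t (n + 1)]
    push_cast
    ring
  rw [mul_comm, ← eq_div_iff (by positivity)] at h₂
  rw [mul_comm, ← eq_div_iff (by positivity)] at h₃
  rw [regularFactor, regularFactor, h₂, h₃]
  field_simp
  ring

/-- The polynomial part of the telescoping certificate for `R n 0`. -/
noncomputable def certPoly (n : ℕ) (t : ℝ) : ℝ :=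
  -(12 + 122 * n + 508 * n ^ 2 + 1104 * n ^ 3 + 1240 * n ^ 4 + 566 * n ^ 5 +
    (44 + 387 * n + 1339 * n ^ 2 + 2045 * n ^ 3 + 1145 * n ^ 4) * t +
    (77 + 558 * n + 1205 * n ^ 2 + 820 * n ^ 3) * t ^ 2 +
    (77 + 250 * n + 205 * n ^ 2) * t ^ 3) / (4 * (2 * n + 1))

/-- The telescoping certificate for `R n 0`. -/
noncomputable def cert (n : ℕ) (t : ℝ) : ℝ :=
  poch (t + -(2 * n + 1)) (2 * n + 1) * regularFactor n t * certPoly n t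

theorem telescoping (n : ℕ) {t : ℝ} (ht : 0 < t) :
    -16 * (2 * (n : ℝ) + 1) ^ 4 * R n 0 t - ((n : ℝ) + 1) ^ 4 * R (n + 1) 0 t =
      cert n (t + 1) - cert n t := by
  have h₁ : poch (t + 1 + -(2 * n + 1)) (2 * n + 1) = poch (t + -(2 * n)) (2 * n) * t := by
    rw [show t + 1 + -(2 * (n : ℝ) + 1) = t + -(2 * n) by ring, poch_succ]
    push_cast
    ring
  have h₂ : poch (t + -(2 * n + 1)) (2 * n + 1) =
      (t - 2 * n - 1) * poch (t + -(2 * n)) (2 * n) := by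
    rw [poch_succ_left, show t + -(2 * (n : ℝ) + 1) + 1 = t + -(2 * n) by ring]
    ring
  have h₃ : poch (t + -(2 * (n + 1 : ℕ))) (2 * (n + 1)) =
      (t - 2 * n - 2) * ((t - 2 * n - 1) * poch (t + -(2 * n)) (2 * n)) := by
    rw [← h₂, show 2 * (n + 1) = 2 * n + 1 + 1 by ring, poch_succ_left,
      show t + -(2 * ((n + 1 : ℕ) : ℝ)) + 1 = t + -(2 * n + 1) by push_cast; ring]
    push_cast
    ring
  rw [R_zero_eq n ht, R_zero_eq (n + 1) ht, cert, cert, h₁, h₂, h₃, regularFactor_succ n ht,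
    regularFactor_add_one n ht, certPoly, certPoly]
  have : t + n + 1 ≠ 0 := by positivity
  push_cast
  field_simp
  ring

theorem isSymbol_regularFactor (n : ℕ) : IsSymbol (-2 * n - 4) (regularFactor n) := by
  have := (IsSymbol.const ((n.factorial : ℝ) ^ 2 / (2 * n).factorial)).mul
    ((IsSymbol.poch_add ((n : ℝ) + 1) (2 * n)).mul ((IsSymbol.inv_poch (n + 1)).pow 4))
  exact this.of_le (by push_cast; lia)

theorem isSymbol_R (n : ℕ) : IsSymbol (-3) (R n 0) := by
  have := ((IsSymbol.id_add ((n : ℝ) / 2)).mul (IsSymbol.poch_add (-(2 * n)) (2 * n))).mul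
    (isSymbol_regularFactor n)
  refine (this.of_le (by push_cast; lia)).congr ?_
  filter_upwards [eventually_gt_atTop 0] with t ht using (R_zero_eq n ht).symm

theorem isSymbol_certPoly (n : ℕ) : IsSymbol 3 (certPoly n) := by
  have ht : IsSymbol 1 fun t => t := by simpa using IsSymbol.id_add 0
  have hc : ∀ (c : ℝ) (j : ℕ), j ≤ 3 → IsSymbol 3 fun t => c * t ^ j := fun c j hj =>
    ((IsSymbol.const c).mul (ht.pow j)).of_le (by lia)
  convert (((hc (-(12 + 122 * n + 508 * n ^ 2 + 1104 * n ^ 3 + 1240 * n ^ 4 + 566 * n ^ 5) /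
      (4 * (2 * n + 1))) 0 (by simp)).add
    (hc (-(44 + 387 * n + 1339 * n ^ 2 + 2045 * n ^ 3 + 1145 * n ^ 4) / (4 * (2 * n + 1))) 1
      (by simp))).add
    (hc (-(77 + 558 * n + 1205 * n ^ 2 + 820 * n ^ 3) / (4 * (2 * n + 1))) 2 (by simp))).add
    (hc (-(77 + 250 * n + 205 * n ^ 2) / (4 * (2 * n + 1))) 3 (by simp)) using 1
  ext t
  rw [certPoly]
  ring

theorem isSymbol_cert (n : ℕ) : IsSymbol 0 (cert n) :=
  (((IsSymbol.poch_add (-(2 * n + 1)) (2 * n + 1)).mul (isSymbol_regularFactor n)).mul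
    (isSymbol_certPoly n)).of_le (by push_cast; lia)

theorem summable_deriv_R (n : ℕ) : Summable fun k : ℕ => deriv (R n 0) k := by
  refine summable_of_isBigO_nat (g := fun k : ℕ => ((k : ℝ) ^ 4)⁻¹)
    (Real.summable_nat_pow_inv.2 (by norm_num)) ?_
  have := (isSymbol_R n).isBigO_deriv.comp_tendsto tendsto_natCast_atTop_atTop
  refine this.congr_right fun k => ?_
  simp only [Function.comp]
  rw [show (-3 - 1 : ℤ) = -(4 : ℕ) by norm_num, zpow_neg, zpow_natCast]

theorem tendsto_deriv_cert (n : ℕ) :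
    Tendsto (fun k : ℕ => deriv (cert n) k) atTop (𝓝 0) := by
  refine ((isSymbol_cert n).isBigO_deriv.comp_tendsto tendsto_natCast_atTop_atTop).trans_tendsto ?_
  have : (fun k : ℝ => k ^ (0 - 1 : ℤ)) = fun k => k⁻¹ := by
    ext k
    simp
  rw [this]
  exact tendsto_inv_atTop_zero.comp tendsto_natCast_atTop_atTop

theorem differentiableAt_regularFactor (n : ℕ) {t : ℝ} (ht : 0 < t) :
    DifferentiableAt ℝ (regularFactor n) t := by
  have h₁ := (poch_pos ht (n + 1)).ne'
  have h₂ := differentiableAt_poch_add ((n : ℝ) + 1) (2 * n) t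
  exact ((h₂.mul (((differentiable_poch (n + 1)) t).fun_inv h₁ |>.fun_pow 4)).const_mul _)

theorem differentiableAt_R (n : ℕ) {t : ℝ} (ht : 0 < t) : DifferentiableAt ℝ (R n 0) t := by
  have h₁ := differentiableAt_regularFactor n ht
  have h₂ := differentiableAt_poch_add (-(2 * n)) (2 * n) t
  have h₃ : DifferentiableAt ℝ
      (fun t => (t + n / 2) * poch (t + -(2 * n)) (2 * n) * regularFactor n t) t := by
    fun_prop
  refine h₃.congr_of_eventuallyEq ?_
  filter_upwards [lt_mem_nhds ht] with s hs using R_zero_eq n hs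

theorem differentiable_certPoly (n : ℕ) : Differentiable ℝ (certPoly n) := by
  unfold certPoly
  fun_prop

theorem differentiableAt_cert (n : ℕ) {t : ℝ} (ht : 0 < t) :
    DifferentiableAt ℝ (cert n) t := by
  have h₁ := differentiableAt_regularFactor n ht
  have h₂ := differentiableAt_poch_add (-(2 * n + 1)) (2 * n + 1) t
  exact (h₂.mul h₁).mul (differentiable_certPoly n t)

theorem deriv_telescoping (n : ℕ) {t : ℝ} (ht : 0 < t) :
    -16 * (2 * (n : ℝ) + 1) ^ 4 * deriv (R n 0) t -
        ((n : ℝ) + 1) ^ 4 * deriv (R (n + 1) 0) t =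
      deriv (cert n) (t + 1) - deriv (cert n) t := by
  have h₁ := ((differentiableAt_R n ht).hasDerivAt.const_mul (-16 * (2 * (n : ℝ) + 1) ^ 4)).fun_sub
    ((differentiableAt_R (n + 1) ht).hasDerivAt.const_mul (((n : ℝ) + 1) ^ 4))
  have h₂ := ((differentiableAt_cert n (t := t + 1) (by positivity)).hasDerivAt.comp_add_const
    t 1).fun_sub (differentiableAt_cert n ht).hasDerivAt
  refine h₁.unique (h₂.congr_of_eventuallyEq ?_)
  filter_upwards [lt_mem_nhds ht] with s hs using telescoping n hs

theorem hasDerivAt_poch_mul (n : ℕ) {K : ℝ → ℝ} (hK : DifferentiableAt ℝ K (n + 1)) :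
    HasDerivAt (fun t => poch (t + -(2 * n + 1)) (2 * n + 1) * K t)
      ((-1) ^ n * (n.factorial : ℝ) ^ 2 * K (n + 1)) (n + 1) := by
  have h : ∀ t : ℝ, poch (t + -(2 * n + 1)) (2 * n + 1) =
      (t - (n + 1)) * (poch (t + -(2 * n + 1)) n * poch (t + -n) n) := by
    intro t
    rw [show 2 * n + 1 = (n + 1) + n by ring, poch_add, poch_succ,
      show t + -(2 * (n : ℝ) + 1) + (n + 1 : ℕ) = t + -n by push_cast; ring]
    ring
  have h₁ := differentiableAt_poch_add (-(2 * n + 1)) n (n + 1)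
  have h₂ := differentiableAt_poch_add (-n) n (n + 1)
  have h₃ := ((hasDerivAt_id ((n : ℝ) + 1)).sub_const ((n : ℝ) + 1)).fun_mul
    ((h₁.fun_mul h₂).fun_mul hK).hasDerivAt
  have h₄ : poch ((n : ℝ) + 1 + -(2 * n + 1)) n = (-1) ^ n * n.factorial := by
    rw [← poch_neg_natCast]
    congr 1
    ring
  have h₅ : poch ((n : ℝ) + 1 + -n) n = n.factorial := by
    have := poch_natCast_succ 0 n
    rw [show (n : ℝ) + 1 + -n = ((0 : ℕ) : ℝ) + 1 by simp]
    simpa using this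
  refine (h₃.congr_deriv ?_).congr_of_eventuallyEq (Eventually.of_forall fun t => ?_)
  · simp only [h₄, h₅, id]
    ring
  · simp only [h, id, mul_assoc]

theorem deriv_cert_natCast_succ (n : ℕ) : deriv (cert n) (n + 1) =
    (-1) ^ n * (n.factorial : ℝ) ^ 2 * (regularFactor n (n + 1) * certPoly n (n + 1)) := by
  have h := hasDerivAt_poch_mul n (K := fun t => regularFactor n t * certPoly n t)
    ((differentiableAt_regularFactor n (by positivity)).mul (differentiable_certPoly n _))
  rw [← h.deriv]
  congr 1
  ext t
  rw [cert, mul_assoc]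

theorem deriv_R_succ_natCast_succ (n : ℕ) : deriv (R (n + 1) 0) (n + 1) =
    (-1) ^ n * (n.factorial : ℝ) ^ 2 *
      (-(3 * ((n : ℝ) + 1) ^ 2 / 2) * regularFactor (n + 1) (n + 1)) := by
  have hr := differentiableAt_regularFactor (n + 1) (t := n + 1) (by positivity)
  have h := hasDerivAt_poch_mul n
    (K := fun t => (t + (n + 1) / 2) * (t - 2 * n - 2) * regularFactor (n + 1) t) (by fun_prop)
  have h' : R (n + 1) 0 =ᶠ[𝓝 ((n : ℝ) + 1)] fun t => poch (t + -(2 * n + 1)) (2 * n + 1) *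
      ((t + (n + 1) / 2) * (t - 2 * n - 2) * regularFactor (n + 1) t) := by
    filter_upwards [lt_mem_nhds (show (0 : ℝ) < n + 1 by positivity)] with t ht
    rw [R_zero_eq (n + 1) ht, show 2 * (n + 1) = 2 * n + 1 + 1 by ring, poch_succ_left,
      show t + -(2 * ((n + 1 : ℕ) : ℝ)) + 1 = t + -(2 * n + 1) by push_cast; ring]
    push_cast
    ring
  rw [(h.congr_of_eventuallyEq h').deriv]
  ring

theorem regularFactor_natCast_succ (n : ℕ) :
    regularFactor n (n + 1) = (n.factorial : ℝ) ^ 6 * poch (1 + 2 * (n : ℝ)) (2 * n) *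
      (1 + 4 * n) / ((2 * n + 1).factorial : ℝ) ^ 5 := by
  have h₁ := poch_natCast_succ n (n + 1)
  rw [show n + (n + 1) = 2 * n + 1 by ring] at h₁
  have h₂ : (1 + 2 * (n : ℝ)) * poch ((n : ℝ) + 1 + (n + 1)) (2 * n) =
      poch (1 + 2 * (n : ℝ)) (2 * n) * (1 + 4 * n) := by
    rw [show (n : ℝ) + 1 + (n + 1) = 1 + 2 * n + 1 by ring, ← poch_succ_left, poch_succ]
    push_cast
    ring
  rw [← eq_div_iff (by positivity)] at h₁
  rw [mul_assoc _ (poch _ _), ← h₂, regularFactor, h₁, Nat.factorial_succ]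
  push_cast
  field_simp
  ring

/-- The first-order inhomogeneous recurrence in `n` satisfied by `Z_l(n,0)`. -/
theorem Zl_n_zero_recurrence (n : ℕ) :
    -16 * (2 * (n : ℝ) + 1) ^ 4 * Zl n 0 - ((n : ℝ) + 1) ^ 4 * Zl (n + 1) 0 =
      -((-1 : ℝ) ^ n * (n.factorial : ℝ) ^ 8 * poch (1 + 2 * (n : ℝ)) (2 * n) *
          (1 + 4 * (n : ℝ)) *
          (831 + 5265 * (n : ℝ) + 12601 * (n : ℝ) ^ 2 + 13499 * (n : ℝ) ^ 3
            + 5460 * (n : ℝ) ^ 4)) /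
        (48 * ((2 * n + 1).factorial : ℝ) ^ 5) := by
  have hs : ∀ m j : ℕ, Summable fun k : ℕ => deriv (R m 0) ((j : ℝ) + k) := by
    intro m j
    simpa [add_comm] using (summable_nat_add_iff j).2 (summable_deriv_R m)
  have hZ : ∀ m : ℕ, Zl m 0 = -(1 / 3) * ∑' k : ℕ, deriv (R m 0) (((m + 1 : ℕ) : ℝ) + k) := by
    intro m
    simp [Zl]
  have h₁ : ∑' k : ℕ, deriv (R (n + 1) 0) (((n + 1 : ℕ) : ℝ) + k) =
      deriv (R (n + 1) 0) (n + 1) +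
        ∑' k : ℕ, deriv (R (n + 1) 0) (((n + 1 + 1 : ℕ) : ℝ) + k) := by
    rw [(hs (n + 1) (n + 1)).tsum_eq_zero_add]
    congr 1
    · simp
    · refine tsum_congr fun k => ?_
      congr 1
      push_cast
      ring
  have h₂ : HasSum (fun k : ℕ => -16 * (2 * (n : ℝ) + 1) ^ 4 *
        deriv (R n 0) (((n + 1 : ℕ) : ℝ) + k) -
      ((n : ℝ) + 1) ^ 4 * deriv (R (n + 1) 0) (((n + 1 : ℕ) : ℝ) + k))
      (-deriv (cert n) (n + 1)) := by
    refine (((hs n (n + 1)).mul_left _).sub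
      ((hs (n + 1) (n + 1)).mul_left _)).hasSum_iff_tendsto_nat.2 ?_
    have h : ∀ k : ℕ, -16 * (2 * (n : ℝ) + 1) ^ 4 * deriv (R n 0) (((n + 1 : ℕ) : ℝ) + k) -
        ((n : ℝ) + 1) ^ 4 * deriv (R (n + 1) 0) (((n + 1 : ℕ) : ℝ) + k) =
        deriv (cert n) ((k + 1 + (n + 1) : ℕ) : ℝ) - deriv (cert n) ((k + (n + 1) : ℕ) : ℝ) := by
      intro k
      rw [deriv_telescoping n (by positivity)]
      push_cast
      congr 2 <;> ring
    simp only [h]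
    simp only [Finset.sum_range_sub fun k : ℕ => deriv (cert n) ((k + (n + 1) : ℕ) : ℝ)]
    simpa using ((tendsto_add_atTop_iff_nat (n + 1)).2 (tendsto_deriv_cert n)).sub_const
      (deriv (cert n) (n + 1))
  have h₃ := h₂.unique (((hs n (n + 1)).hasSum.mul_left _).sub
      ((hs (n + 1) (n + 1)).hasSum.mul_left _))
  rw [h₁, deriv_cert_natCast_succ, deriv_R_succ_natCast_succ,
    regularFactor_succ n (by positivity), regularFactor_natCast_succ] at h₃
  rw [hZ, hZ]
  generalize (∑' k : ℕ, deriv (R n 0) (((n + 1 : ℕ) : ℝ) + k)) = A at *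
  generalize (∑' k : ℕ, deriv (R (n + 1) 0) (((n + 1 + 1 : ℕ) : ℝ) + k)) = B at *
  have h₄ := (sub_eq_iff_eq_add.1 h₃.symm)
  trans -(1 / 3) * (-16 * (2 * (n : ℝ) + 1) ^ 4 * A - ((n : ℝ) + 1) ^ 4 * B)
  · ring
  rw [h₄, certPoly]
  field_simp
  ring
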